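/- Friedberg jump inversion theorem: For every q ∈ ℕ^ℕ with 0' ≤_T q there exists a p ∈ ℕ^ℕ with p' ≡_T q, where p' = J(p) is the Turing jump of p. -/

import Mathlib

open scoped Classical

namespace LimitComp

/-- Baire space `ℕ^ℕ`. -/
abbrev Baire : Type := ℕ → ℕ

/-- The finite prefix of length `k` of a point of Baire space. -/
def pre (p : Baire) (k : ℕ) : List ℕ := List.ofFn fun i : Fin k => p i

/-- Interleaving pairing `⟨q,p⟩(2n) = q(n)`, `⟨q,p⟩(2n+1) = p(n)`. -/
def pairB (q p : Baire) : Baire := fun n => if n % 2 = 0 then q (n / 2) else p (n / 2)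

/-- The `i`-th component of a tupling `⟨p₀,p₁,p₂,...⟩`. -/
def seqOf (p : Baire) (i : ℕ) : Baire := fun n => p (Nat.pair i n)

/-- Tupling `⟨p₀,p₁,p₂,...⟩` of a sequence of points of Baire space. -/
def tup (ps : ℕ → Baire) : Baire := fun m => ps m.unpair.1 m.unpair.2

/-- The limit map `lim :⊆ ℕ^ℕ → ℕ^ℕ`; it maps `⟨p₀,p₁,p₂,...⟩` to its pointwise
limit, which is defined whenever every coordinate is eventually constant. -/
noncomputable def limB : Baire →. Baire := fun p =>
  ⟨∀ n, ∃ i₀, ∀ i, i₀ ≤ i → seqOf p i n = seqOf p i₀ n,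
   fun h n => seqOf p (Classical.choose (h n)) n⟩

/-- Monotonicity of a finite approximation function under prefix extension
(this corresponds to a one-way output tape). -/
def PrefixMono (η : List ℕ → ℕ → Option ℕ) : Prop :=
  ∀ u v n y, u <+: v → η u n = some y → η v n = some y

/-- `η` approximates the partial function `F`: for every input in the domain of `F`
every output position is eventually filled with the correct output value. -/
def OneWayApprox (η : List ℕ → ℕ → Option ℕ) (F : Baire →. Baire) : Prop :=
  ∀ p q, q ∈ F p → ∀ n, ∃ k, η (pre p k) n = some (q n)

/-- Computability for partial functions on Baire space: `F` is computed by a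
Turing machine with one-way output tape, formalized via a computable monotone
finite approximation function. -/
def ComputableFn (F : Baire →. Baire) : Prop :=
  ∃ η : List ℕ → ℕ → Option ℕ, Computable₂ η ∧ PrefixMono η ∧ OneWayApprox η F

/-- `η` is a limit approximation of `F`: on every input in the domain of `F`,
every output cell eventually stabilizes to the correct output value. -/
def LimitApprox (η : List ℕ → ℕ → ℕ) (F : Baire →. Baire) : Prop :=
  ∀ p q, q ∈ F p → ∀ n, ∃ k₀, ∀ k, k₀ ≤ k → η (pre p k) n = q n

/-- Limit computability for partial functions on Baire space: `F` is computed by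
a Turing machine with a two-way output tape such that on inputs in the domain
every output cell eventually stabilizes. -/
def LimitComputableFn (F : Baire →. Baire) : Prop :=
  ∃ η : List ℕ → ℕ → ℕ, Computable₂ η ∧ LimitApprox η F

/-- The `i`-th Turing machine halts on input `p ∈ ℕ^ℕ` (i.e. it halts after
having read some finite prefix of `p`). -/
def haltsOn (i : ℕ) (p : Baire) : Prop :=
  ∃ k, ((Denumerable.ofNat Nat.Partrec.Code i).eval (Encodable.encode (pre p k))).Dom

/-- The Turing jump operator `J : ℕ^ℕ → ℕ^ℕ`. -/
noncomputable def jump (p : Baire) : Baire := fun i => if haltsOn i p then 1 else 0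

/-- The halting problem `0'`. -/
noncomputable def zero' : Baire := jump fun _ => 0

/-- `F` is computable relative to the oracle `q`. -/
def ComputableRel (q : Baire) (F : Baire →. Baire) : Prop :=
  ∃ G : Baire →. Baire, ComputableFn G ∧ ∀ p r, r ∈ F p → r ∈ G (pairB q p)

/-- `F` is limit computable relative to the oracle `q`. -/
def LimitComputableRel (q : Baire) (F : Baire →. Baire) : Prop :=
  ∃ G : Baire →. Baire, LimitComputableFn G ∧ ∀ p r, r ∈ F p → r ∈ G (pairB q p)

/-- Turing reducibility for points of Baire space. -/
def TuringLe (p q : Baire) : Prop :=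
  ∃ F : Baire →. Baire, ComputableFn F ∧ p ∈ F q

end LimitComp

namespace LimitComp

open Filter Encodable Nat.Partrec

section Prefix

variable (p : Baire)

@[simp] theorem length_pre (k : ℕ) : (pre p k).length = k := by simp [pre]

theorem getElem?_pre_of_lt {i k : ℕ} (h : i < k) : (pre p k)[i]? = some (p i) := by
  simp [pre, h]

theorem eq_of_mem_getElem?_pre {i k y : ℕ} (h : y ∈ (pre p k)[i]?) : y = p i := by
  rw [Option.mem_def] at h
  have hi : i < k := by
    by_contra hi
    rw [List.getElem?_eq_none (by simpa using hi)] at h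
    cases h
  rw [getElem?_pre_of_lt p hi] at h
  exact (Option.some.inj h).symm

theorem take_pre {j k : ℕ} (h : j ≤ k) : (pre p k).take j = pre p j := by
  apply List.ext_getElem <;> simp [pre, h]

theorem take_pre_eq_pre_min (j k : ℕ) : (pre p k).take j = pre p (min j k) := by
  apply List.ext_getElem <;> simp [pre]

theorem pre_prefix_pre {j k : ℕ} (h : j ≤ k) : pre p j <+: pre p k :=
  take_pre p h ▸ List.take_prefix _ _

end Prefix

/-- The partial function `F` on finite prefixes approximates the value `b` along `q`: it never
takes another value on a prefix of `q`, and takes it on all long enough prefixes. -/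
def Along {β : Type*} (q : Baire) (F : List ℕ → Part β) (b : β) : Prop :=
  (∀ k, ∀ y ∈ F (pre q k), y = b) ∧ ∀ᶠ k in atTop, b ∈ F (pre q k)

namespace Along

variable {β γ : Type*} {q : Baire}

theorem const (b : β) : Along q (fun _ => Part.some b) b := by
  simp [Along]

theorem bind {F : List ℕ → Part β} {G : List ℕ → β → Part γ} {b : β} {c : γ}
    (hF : Along q F b) (hG : Along q (fun u => G u b) c) :
    Along q (fun u => (F u).bind (G u)) c := by
  refine ⟨fun k y hy => ?_, ?_⟩
  · obtain ⟨x, hx, hy⟩ := Part.mem_bind_iff.1 hy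
    rw [hF.1 k x hx] at hy
    exact hG.1 k y hy
  · filter_upwards [hF.2, hG.2] with k h₁ h₂ using Part.mem_bind h₁ h₂

theorem map {F : List ℕ → Part β} {b : β} (hF : Along q F b) (g : β → γ) :
    Along q (fun u => (F u).map (g)) (g b) := by
  refine ⟨fun k y hy => ?_, ?_⟩
  · obtain ⟨x, hx, rfl⟩ := (Part.mem_map_iff _).1 hy
    rw [hF.1 k x hx]
  · filter_upwards [hF.2] with k h₁ using Part.mem_map g h₁

theorem getElem? (i : ℕ) : Along q (fun u => (u[i]? : Part ℕ)) (q i) := by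
  refine ⟨fun k y hy => eq_of_mem_getElem?_pre q (Part.mem_ofOption.1 hy), ?_⟩
  filter_upwards [eventually_gt_atTop i] with k hk
  exact Part.mem_ofOption.2 (getElem?_pre_of_lt q hk)

theorem rfind {P : List ℕ → ℕ → Part Bool} {b : ℕ → Bool} (hP : ∀ n, Along q (fun u => P u n) (b n))
    {n : ℕ} (hn : b n = true) (hlt : ∀ m < n, b m = false) :
    Along q (fun u => Nat.rfind (P u)) n := by
  refine ⟨fun k y hy => ?_, ?_⟩
  · obtain ⟨h₁, h₂⟩ := Nat.mem_rfind.1 hy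
    have h₃ := (hP y).1 k _ h₁
    rcases lt_trichotomy y n with h | h | h
    · rw [hlt y h] at h₃
      cases h₃
    · exact h
    · have h₄ := (hP n).1 k _ (h₂ h)
      rw [hn] at h₄
      cases h₄
  · have h : ∀ᶠ k in atTop, ∀ m ∈ Set.Iic n, b m ∈ P (pre q k) m :=
      (Filter.eventually_all_finite (Set.finite_Iic n)).2 fun m _ => (hP m).2
    filter_upwards [h] with k hk
    refine Nat.mem_rfind.2 ⟨hn ▸ hk n (Set.mem_Iic.2 le_rfl), fun {m} hm =>
      hlt m hm ▸ hk m (Set.mem_Iic.2 hm.le)⟩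

theorem nat_rec {F : ℕ → List ℕ → β → Part β} {s : ℕ → β}
    (h : ∀ i, Along q (fun u => F i u (s i)) (s (i + 1))) (n : ℕ) :
    Along q (fun u => Nat.rec (motive := fun _ => Part β) (Part.some (s 0))
      (fun i IH => IH.bind (F i u)) n) (s n) := by
  induction n with
  | zero => exact const _
  | succ n ih => exact ih.bind (h n)

end Along

/-- The first value found by the code `c` on an initial segment of `u`, where the `m`-th attempt
is to run `c` for `m.unpair.2` steps on the initial segment of length `m.unpair.1`. -/
def firstOutput (c : Code) (u : List ℕ) (n : ℕ) (N : ℕ) : Option ℕ :=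
  Nat.rec none (fun m IH => IH <|> Code.evaln m.unpair.2 c (encode (u.take m.unpair.1, n))) N

theorem firstOutput_succ (c : Code) (u : List ℕ) (n N : ℕ) :
    firstOutput c u n (N + 1) =
      (firstOutput c u n N <|> Code.evaln N.unpair.2 c (encode (u.take N.unpair.1, n))) := rfl

theorem firstOutput_mono (c : Code) (u : List ℕ) (n : ℕ) {M N y : ℕ} (h : M ≤ N)
    (hy : firstOutput c u n M = some y) : firstOutput c u n N = some y := by
  induction N, h using Nat.le_induction with
  | base => exact hy
  | succ N _ ih => simp [firstOutput_succ, ih]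

theorem firstOutput_congr (c : Code) {u v : List ℕ} (n : ℕ) (h : u <+: v) {N : ℕ}
    (hN : N ≤ u.length) : firstOutput c u n N = firstOutput c v n N := by
  induction N with
  | zero => rfl
  | succ N ih =>
    have : u.take N.unpair.1 = v.take N.unpair.1 := by
      obtain ⟨w, rfl⟩ := h
      rw [List.take_append_of_le_length]
      exact (Nat.unpair_left_le N).trans (by omega)
    rw [firstOutput_succ, firstOutput_succ, ih (by omega), this]

theorem exists_of_firstOutput (c : Code) (u : List ℕ) (n : ℕ) {N y : ℕ}
    (h : firstOutput c u n N = some y) : ∃ j, y ∈ c.eval (encode (u.take j, n)) := by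
  induction N with
  | zero => cases h
  | succ N ih =>
    rw [firstOutput_succ] at h
    cases h' : firstOutput c u n N with
    | some z => exact ih (by simpa [h'] using h)
    | none => exact ⟨_, Code.evaln_sound (by simpa [h'] using h)⟩

theorem computable_firstOutput (c : Code) :
    Computable₂ fun u n => firstOutput c u n u.length := by
  have : Primrec fun a : List ℕ × ℕ => firstOutput c a.1 a.2 a.1.length := by
    have hlen : Primrec fun a : List ℕ × ℕ => a.1.length := Primrec.list_length.comp Primrec.fst
    refine Primrec.nat_rec' (h := fun a x => (x.2 <|> Code.evaln x.1.unpair.2 c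
      (encode (a.1.take x.1.unpair.1, a.2)))) hlen (Primrec.const none) ?_
    have hm : Primrec fun z : (List ℕ × ℕ) × ℕ × Option ℕ => z.2.1.unpair :=
      Primrec.unpair.comp (Primrec.fst.comp Primrec.snd)
    refine Primrec.option_orElse.comp (Primrec.snd.comp Primrec.snd) ?_
    have htake : Primrec fun z : (List ℕ × ℕ) × ℕ × Option ℕ =>
        (z.1.1.take z.2.1.unpair.1, z.1.2) :=
      (Primrec.list_take.comp (Primrec.fst.comp hm) (Primrec.fst.comp Primrec.fst)).pair
        (Primrec.snd.comp Primrec.fst)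
    exact Code.primrec_evaln.comp (((Primrec.snd.comp hm).pair (Primrec.const c)).pair
      (Primrec.encode.comp htake))
  exact this.to_comp

theorem turingLe_iff {p q : Baire} :
    TuringLe p q ↔ ∃ η : List ℕ → ℕ → Option ℕ, Computable₂ η ∧ PrefixMono η ∧
      ∀ n, ∃ k, η (pre q k) n = some (p n) := by
  constructor
  · rintro ⟨F, ⟨η, h₁, h₂, h₃⟩, h⟩
    exact ⟨η, h₁, h₂, h₃ q p h⟩
  · rintro ⟨η, h₁, h₂, h₃⟩
    refine ⟨fun x => ⟨x = q, fun _ => p⟩, ⟨η, h₁, h₂, ?_⟩, rfl, rfl⟩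
    rintro x y ⟨hx, hy⟩
    change x = q at hx
    change p = y at hy
    subst hx hy
    exact h₃

theorem turingLe_of_along {p q : Baire} {f : List ℕ → ℕ → Part ℕ} (hf : Partrec₂ f)
    (h : ∀ n, Along q (fun u => f u n) (p n)) : TuringLe p q := by
  obtain ⟨c, hc⟩ := Code.exists_code.1 hf
  have hc' : ∀ u n, c.eval (encode (u, n)) = f u n := by
    intro u n
    simp [hc, Part.map_id']
  refine turingLe_iff.2 ⟨fun u n => firstOutput c u n u.length, computable_firstOutput c, ?_, ?_⟩
  · intro u v n y huv hy
    dsimp only at hy ⊢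
    rw [firstOutput_congr c n huv le_rfl] at hy
    exact firstOutput_mono c v n huv.length_le hy
  · intro n
    obtain ⟨j, hj⟩ := (h n).2.exists
    replace hj : p n ∈ c.eval (encode (pre q j, n)) := (hc' (pre q j) n).symm ▸ hj
    obtain ⟨t, ht⟩ := Code.evaln_complete.1 hj
    set k := Nat.pair j t + 1 with hk
    have hjk : j ≤ k := (Nat.left_le_pair j t).trans (Nat.le_succ _)
    refine ⟨k, ?_⟩
    have hsome : ∃ y, firstOutput c (pre q k) n k = some y := by
      rw [hk, firstOutput_succ, Nat.unpair_pair, take_pre q (hk ▸ hjk)]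
      cases firstOutput c (pre q (Nat.pair j t + 1)) n (Nat.pair j t) with
      | some z => exact ⟨z, rfl⟩
      | none => exact ⟨_, by simpa using ht⟩
    obtain ⟨y, hy⟩ := hsome
    obtain ⟨i, hi⟩ := exists_of_firstOutput c _ n hy
    rw [take_pre_eq_pre_min, hc'] at hi
    dsimp only
    rw [length_pre, hy, (h n).1 _ y hi]

theorem exists_along_of_turingLe {p q : Baire} (h : TuringLe p q) :
    ∃ η : List ℕ → ℕ → Option ℕ, Computable₂ η ∧
      ∀ n, Along q (fun u => (η u n : Part ℕ)) (p n) := by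
  obtain ⟨η, hη, hmono, hex⟩ := turingLe_iff.1 h
  refine ⟨η, hη, fun n => ?_⟩
  obtain ⟨k₀, hk₀⟩ := hex n
  refine ⟨fun k y hy => ?_, ?_⟩
  · have hy := Part.mem_ofOption.1 hy
    have h₁ := hmono _ _ n _ (pre_prefix_pre q (le_max_left k k₀)) hy
    have h₂ := hmono _ _ n _ (pre_prefix_pre q (le_max_right k k₀)) hk₀
    exact Option.some.inj (h₁.symm.trans h₂)
  · filter_upwards [eventually_ge_atTop k₀] with k hk
    exact Part.mem_ofOption.2 (hmono _ _ n _ (pre_prefix_pre q hk) hk₀)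

/-- The `s`-`m`-`n` theorem, for domains of partial recursive functions. -/
theorem exists_computable_index {α σ : Type*} [Primcodable α] [Primcodable σ]
    {f : α → ℕ → Part σ} (hf : Partrec₂ f) :
    ∃ c : α → ℕ, Computable c ∧
      ∀ a x, ((Denumerable.ofNat Code (c a)).eval x).Dom ↔ (f a x).Dom := by
  obtain ⟨d, hd⟩ := Code.exists_code.1 hf
  refine ⟨fun a => encode (d.curry (encode a)), ?_, fun a x => ?_⟩
  · exact (Primrec.encode.comp (Code.primrec₂_curry.comp (Primrec.const d) Primrec.encode)).to_comp
  · have : Nat.pair (encode a) x = encode (a, x) := rfl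
    rw [Denumerable.ofNat_encode, Code.eval_curry, this, hd]
    simp

/-- `w` codes an extension of `σ`, a prefix of it and a number of steps
in which the `e`-th machine halts on that prefix. -/
def haltWitness (e : ℕ) (σ : List ℕ) (w : ℕ) : Bool :=
  ((decode w : Option (List ℕ × ℕ × ℕ)).bind fun x =>
    Code.evaln x.2.2 (Denumerable.ofNat Code e) (encode ((σ ++ x.1).take x.2.1))).isSome

/-- The extension of `σ` coded by `w`. -/
def extendBy (σ : List ℕ) (w : ℕ) : List ℕ :=
  σ ++ ((decode w : Option (List ℕ × ℕ × ℕ)).map Prod.fst).getD []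

theorem computable_haltWitness :
    Computable fun a : (ℕ × List ℕ) × ℕ => haltWitness a.1.1 a.1.2 a.2 := by
  refine (Primrec.option_isSome.comp (Primrec.option_bind
    (Primrec.decode.comp Primrec.snd) ?_)).to_comp
  refine Code.primrec_evaln.comp (((Primrec.snd.comp (Primrec.snd.comp Primrec.snd)).pair
    ((Primrec.ofNat Code).comp
      (Primrec.fst.comp (Primrec.fst.comp Primrec.fst)))).pair (Primrec.encode.comp ?_))
  exact Primrec.list_take.comp (Primrec.fst.comp (Primrec.snd.comp Primrec.snd))
    (Primrec.list_append.comp (Primrec.snd.comp (Primrec.fst.comp Primrec.fst))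
      (Primrec.fst.comp Primrec.snd))

theorem computable_extendBy : Computable₂ extendBy := by
  have : Primrec fun a : List ℕ × ℕ => extendBy a.1 a.2 :=
    Primrec.list_append.comp Primrec.fst (Primrec.option_getD.comp
      (Primrec.option_map (Primrec.decode.comp Primrec.snd) (Primrec.fst.comp Primrec.snd))
      (Primrec.const []))
  exact this.to_comp

/-- The least extension of `σ` forcing the `e`-th machine to halt if there is one, else `σ`. -/
noncomputable def force (e : ℕ) (σ : List ℕ) : List ℕ :=
  if h : ∃ w, haltWitness e σ w then extendBy σ (Nat.find h) else σ

/-- The search for the least extension of `σ` forcing the `e`-th machine to halt,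
carried out only if the bit `b` promises success. -/
def forceSearch (e : ℕ) (σ : List ℕ) (b : ℕ) : Part (List ℕ) :=
  Nat.casesOn b (Part.some σ) fun _ =>
    (Nat.rfind fun w => Part.some (haltWitness e σ w)).map (extendBy σ)

theorem rfind_some_dom (P : ℕ → Bool) : (Nat.rfind fun n => Part.some (P n)).Dom ↔ ∃ n, P n := by
  refine Nat.rfind_dom.trans ?_
  exact ⟨fun ⟨n, h, _⟩ => ⟨n, (Part.mem_some_iff.1 h).symm⟩,
    fun ⟨n, h⟩ => ⟨n, Part.mem_some_iff.2 h.symm, fun _ => trivial⟩⟩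

theorem partrec_rfind_haltWitness :
    Partrec fun a : ℕ × List ℕ => Nat.rfind fun w => Part.some (haltWitness a.1 a.2 w) :=
  Partrec.rfind (p := fun (a : ℕ × List ℕ) w => Part.some (haltWitness a.1 a.2 w))
    (Computable.partrec computable_haltWitness)

theorem partrec_forceSearch :
    Partrec fun a : (ℕ × List ℕ) × ℕ => forceSearch a.1.1 a.1.2 a.2 := by
  have hmap : Partrec fun a : (ℕ × List ℕ) =>
      (Nat.rfind fun w => Part.some (haltWitness a.1 a.2 w)).map (extendBy a.2) :=
    Partrec.map partrec_rfind_haltWitness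
      (computable_extendBy.comp (Computable.snd.comp Computable.fst) Computable.snd).to₂
  have hmap' : Partrec₂ fun (a : (ℕ × List ℕ) × ℕ) (_ : ℕ) =>
      (Nat.rfind fun w => Part.some (haltWitness a.1.1 a.1.2 w)).map (extendBy a.1.2) :=
    (hmap.comp (Computable.fst.comp Computable.fst)).to₂
  refine (Partrec.nat_casesOn_right Computable.snd
    (Computable.snd.comp Computable.fst) hmap').of_eq fun a => ?_
  rfl

theorem forceSearch_eq_some (e : ℕ) (σ : List ℕ) {b : ℕ}
    (hb : b = if ∃ w, haltWitness e σ w then 1 else 0) :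
    forceSearch e σ b = Part.some (force e σ) := by
  unfold force
  split_ifs at hb ⊢ with h
  · subst hb
    have : Nat.rfind (fun w => Part.some (haltWitness e σ w)) = Part.some (Nat.find h) := by
      refine Part.eq_some_iff.2 (Nat.mem_rfind.2 ⟨?_, fun {m} hm => ?_⟩)
      · simpa using (Nat.find_spec h).symm
      · simpa using Nat.find_min h hm
    simp [forceSearch, this]
  · subst hb
    rfl

theorem prefix_force (e : ℕ) (σ : List ℕ) : σ <+: force e σ := by
  unfold force extendBy
  split_ifs <;> simp

/-- The finite initial segments of the generic point built from `q`: at stage `s` the `s`-th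
machine is forced to halt if possible, and then `q s` is appended. -/
noncomputable def stage (q : Baire) : ℕ → List ℕ
  | 0 => []
  | s + 1 => force s (stage q s) ++ [q s]

theorem stage_prefix_stage (q : Baire) {s t : ℕ} (h : s ≤ t) : stage q s <+: stage q t := by
  induction t, h using Nat.le_induction with
  | base => exact List.prefix_rfl
  | succ t _ ih => exact ih.trans ((prefix_force _ _).trans (List.prefix_append _ _))

theorem le_length_stage (q : Baire) (s : ℕ) : s ≤ (stage q s).length := by
  induction s with
  | zero => simp
  | succ s ih =>
    have := (prefix_force s (stage q s)).length_le
    simp only [stage, List.length_append, List.length_singleton]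
    omega

/-- The point with initial segments `stage q s`. -/
noncomputable def generic (q : Baire) : Baire := fun n => (stage q (n + 1)).getD n 0

theorem getElem?_stage (q : Baire) {s n : ℕ} (h : n < (stage q s).length) :
    (stage q s)[n]? = some (generic q n) := by
  have hn : n < (stage q (n + 1)).length := le_length_stage q (n + 1)
  have key : (stage q s)[n]? = (stage q (n + 1))[n]? := by
    rcases le_total s (n + 1) with hs | hs
    · obtain ⟨w, hw⟩ := stage_prefix_stage q hs
      rw [← hw, List.getElem?_append_left h]
    · obtain ⟨w, hw⟩ := stage_prefix_stage q hs
      rw [← hw, List.getElem?_append_left hn]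
  rw [key, generic, List.getD_eq_getElem?_getD, List.getElem?_eq_getElem hn, Option.getD_some]

theorem pre_generic_length_stage (q : Baire) (s : ℕ) :
    pre (generic q) (stage q s).length = stage q s := by
  refine List.ext_getElem? fun n => ?_
  rcases lt_or_ge n (stage q s).length with h | h
  · rw [getElem?_pre_of_lt _ h, getElem?_stage q h]
  · rw [List.getElem?_eq_none (by simpa using h), List.getElem?_eq_none h]

theorem generic_length_force (q : Baire) (s : ℕ) :
    generic q (force s (stage q s)).length = q s := by
  have h := getElem?_stage q (s := s + 1) (n := (force s (stage q s)).length) (by simp [stage])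
  simpa [stage] using h.symm

theorem haltsOn_generic_iff (q : Baire) (e : ℕ) :
    haltsOn e (generic q) ↔ ∃ w, haltWitness e (stage q e) w := by
  constructor
  · rintro ⟨k, hk⟩
    obtain ⟨y, hy⟩ := Part.dom_iff_mem.1 hk
    obtain ⟨t, ht⟩ := Code.evaln_complete.1 hy
    obtain ⟨ρ, hρ⟩ := stage_prefix_stage q (le_max_left e k)
    refine ⟨encode (ρ, k, t), ?_⟩
    have hlen : k ≤ (stage q (max e k)).length := (le_max_right e k).trans (le_length_stage q _)
    have : (stage q e ++ ρ).take k = pre (generic q) k := by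
      rw [hρ, ← pre_generic_length_stage, take_pre _ hlen]
    simp only [haltWitness, encodek, Option.bind_some, this]
    exact Option.isSome_iff_exists.2 ⟨y, ht⟩
  · intro h
    have hforce : force e (stage q e) = extendBy (stage q e) (Nat.find h) := dif_pos h
    have hw := Nat.find_spec h
    obtain ⟨y, hy⟩ := Option.isSome_iff_exists.1 hw
    obtain ⟨x, hx, hy⟩ := Option.bind_eq_some_iff.1 hy
    have hext : stage q e ++ x.1 = force e (stage q e) := by
      rw [hforce, extendBy, hx]
      rfl
    have hpre : force e (stage q e) <+: stage q (e + 1) := List.prefix_append _ _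
    have : (stage q e ++ x.1).take x.2.1 =
        pre (generic q) (min x.2.1 (force e (stage q e)).length) := by
      rw [hext, List.prefix_iff_eq_take.1 hpre, ← pre_generic_length_stage q (e + 1),
        take_pre _ hpre.length_le, take_pre_eq_pre_min, length_pre]
    rw [this] at hy
    exact ⟨_, Part.dom_iff_mem.2 ⟨y, Code.evaln_sound hy⟩⟩

theorem jump_generic (q : Baire) (e : ℕ) :
    jump (generic q) e = if ∃ w, haltWitness e (stage q e) w then 1 else 0 := by
  simp only [jump, haltsOn_generic_iff]

theorem forceSearch_jump_generic (q : Baire) (s : ℕ) :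
    forceSearch s (stage q s) (jump (generic q) s) = Part.some (force s (stage q s)) :=
  forceSearch_eq_some _ _ (jump_generic q s)

theorem partrec_iterate {F : ℕ → List ℕ → List ℕ → Part (List ℕ)} {σ₀ : List ℕ}
    (hF : Partrec fun a : List ℕ × ℕ × List ℕ => F a.2.1 a.1 a.2.2) :
    Partrec fun a : List ℕ × ℕ => Nat.rec (motive := fun _ => Part (List ℕ)) (Part.some σ₀)
      (fun i IH => IH.bind (F i a.1)) a.2 := by
  have hF' : Partrec₂ fun (a : List ℕ × ℕ) (x : ℕ × List ℕ) => F x.1 a.1 x.2 :=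
    (hF.comp ((Computable.fst.comp Computable.fst).pair Computable.snd)).to₂
  exact Partrec.nat_rec Computable.snd (Computable.const σ₀).partrec hF'

theorem jump_generic_turingLe {q : Baire} (h : TuringLe zero' q) :
    TuringLe (jump (generic q)) q := by
  obtain ⟨η, hη, hq⟩ := exists_along_of_turingLe h
  obtain ⟨c, hc, hdom⟩ := exists_computable_index
    (f := fun (a : ℕ × List ℕ) (_ : ℕ) => Nat.rfind fun w => Part.some (haltWitness a.1 a.2 w))
    (partrec_rfind_haltWitness.comp Computable.fst).to₂
  have hzero : ∀ e, zero' (c (e, stage q e)) = jump (generic q) e := by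
    intro e
    rw [jump_generic]
    simp only [zero', jump, haltsOn, hdom]
    simp only [rfind_some_dom, exists_const]
  have hbit : ∀ e, Along q (fun u => (η u (c (e, stage q e)) : Part ℕ)) (jump (generic q) e) :=
    fun e => hzero e ▸ hq _
  let F (i : ℕ) (u σ : List ℕ) : Part (List ℕ) := (η u (c (i, σ)) : Part ℕ).bind fun b =>
    (forceSearch i σ b).bind fun τ => (u[i]? : Part ℕ).map fun y => τ ++ [y]
  have hstage := Along.nat_rec (q := q) (s := stage q) (F := F)
    (fun i => (hbit i).bind (by
      rw [forceSearch_jump_generic]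
      exact (Along.const _).bind ((Along.getElem? i).map _)))
  have happend : Partrec₂ fun (a : (List ℕ × ℕ × List ℕ) × ℕ) (τ : List ℕ) =>
      (a.1.1[a.1.2.1]? : Part ℕ).map fun y => τ ++ [y] :=
    Partrec.map (Computable.ofOption (Computable.list_getElem?.comp
        (Computable.fst.comp (Computable.fst.comp Computable.fst))
        (Computable.fst.comp (Computable.snd.comp (Computable.fst.comp Computable.fst)))))
      (Computable.list_concat.comp (Computable.snd.comp Computable.fst) Computable.snd).to₂
  have hsearch : Partrec₂ fun (a : List ℕ × ℕ × List ℕ) (b : ℕ) =>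
      (forceSearch a.2.1 a.2.2 b).bind fun τ => (a.1[a.2.1]? : Part ℕ).map fun y => τ ++ [y] :=
    Partrec.bind (partrec_forceSearch.comp
      ((Computable.snd.comp Computable.fst).pair Computable.snd)) happend
  have hstep : Partrec fun a : List ℕ × ℕ × List ℕ => (η a.1 (c a.2) : Part ℕ).bind fun b =>
      (forceSearch a.2.1 a.2.2 b).bind fun τ => (a.1[a.2.1]? : Part ℕ).map fun y => τ ++ [y] :=
    Partrec.bind (Computable.ofOption (hη.comp Computable.fst (hc.comp Computable.snd))) hsearch
  have hlast : Partrec₂ fun (a : List ℕ × ℕ) (σ : List ℕ) => (η a.1 (c (a.2, σ)) : Part ℕ) :=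
    Computable.ofOption (hη.comp (Computable.fst.comp Computable.fst)
      (hc.comp ((Computable.snd.comp Computable.fst).pair Computable.snd)))
  exact turingLe_of_along (Partrec.bind (partrec_iterate (F := F) (σ₀ := stage q 0) hstep) hlast).to₂
    fun e => (hstage e).bind (G := fun u σ => (η u (c (e, σ)) : Part ℕ)) (hbit e)

theorem turingLe_jump_generic (q : Baire) : TuringLe q (jump (generic q)) := by
  have heq : Computable₂ fun (a : ℕ × ℕ) (x : ℕ) =>
      decide (((decode x : Option (List ℕ)).bind (·[a.1]?)) = some a.2) := by
    have hlookup : Primrec fun z : (ℕ × ℕ) × ℕ => (decode z.2 : Option (List ℕ)).bind (·[z.1.1]?) :=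
      Primrec.option_bind (Primrec.decode.comp Primrec.snd)
        (Primrec.list_getElem?.comp Primrec.snd
          (Primrec.fst.comp (Primrec.fst.comp Primrec.fst))).to₂
    have hval : Primrec fun z : (ℕ × ℕ) × ℕ => some z.1.2 :=
      Primrec.option_some.comp (Primrec.snd.comp Primrec.fst)
    exact (Primrec.eq.comp hlookup hval).decide.to_comp
  obtain ⟨c, hc, hdom⟩ := exists_computable_index
    (f := fun (a : ℕ × ℕ) (x : ℕ) => Nat.rfind fun _ =>
      Part.some (decide (((decode x : Option (List ℕ)).bind (·[a.1]?)) = some a.2)))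
    (Partrec.rfind (p := fun (z : (ℕ × ℕ) × ℕ) (_ : ℕ) =>
      Part.some (decide (((decode z.2 : Option (List ℕ)).bind (·[z.1.1]?)) = some z.1.2)))
      (Computable.partrec (heq.comp (Computable.fst.comp Computable.fst)
        (Computable.snd.comp Computable.fst))).to₂)
  have hhalts : ∀ m y, jump (generic q) (c (m, y)) = 1 ↔ generic q m = y := by
    intro m y
    have : haltsOn (c (m, y)) (generic q) ↔ generic q m = y := by
      simp only [haltsOn, hdom, rfind_some_dom, encodek, Option.bind_some, exists_const,
        decide_eq_true_eq]
      constructor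
      · rintro ⟨k, hk⟩
        exact (eq_of_mem_getElem?_pre _ hk).symm
      · rintro rfl
        exact ⟨m + 1, getElem?_pre_of_lt _ (Nat.lt_succ_self m)⟩
    simp [jump, this]
  have hval : ∀ m, Along (jump (generic q)) (fun u => Nat.rfind fun y =>
      (u[c (m, y)]? : Part ℕ).map fun b => decide (b = 1)) (generic q m) := by
    intro m
    refine Along.rfind (fun n => (Along.getElem? _).map _) ?_ ?_
    · simp [hhalts]
    · intro n hn
      simpa [hhalts] using hn.ne'
  let F (i : ℕ) (u σ : List ℕ) : Part (List ℕ) :=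
    (u[i]? : Part ℕ).bind fun b => (forceSearch i σ b).bind fun τ =>
      (Nat.rfind fun y => (u[c (τ.length, y)]? : Part ℕ).map fun b => decide (b = 1)).map
        fun y => τ ++ [y]
  have hstage := Along.nat_rec (q := jump (generic q)) (s := stage q) (F := F)
    (fun i => (Along.getElem? i).bind (by
      rw [forceSearch_jump_generic]
      refine (Along.const _).bind ?_
      have := (hval (force i (stage q i)).length).map fun y => force i (stage q i) ++ [y]
      rwa [generic_length_force] at this))
  have hlast : ∀ n, (stage q (n + 1)).reverse.headI = q n := by
    intro n
    simp [stage]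
  have hread : Partrec₂ fun (a : List ℕ × List ℕ) (y : ℕ) =>
      (a.1[c (a.2.length, y)]? : Part ℕ).map fun b => decide (b = 1) := by
    refine Partrec.map (Computable.ofOption (Computable.list_getElem?.comp
      (Computable.fst.comp Computable.fst) (hc.comp ((Computable.list_length.comp
        (Computable.snd.comp Computable.fst)).pair Computable.snd)))) ?_
    exact (Primrec.eq.comp Primrec.snd (Primrec.const 1)).decide.to_comp.to₂
  have happend : Partrec fun a : List ℕ × List ℕ =>
      (Nat.rfind fun y => (a.1[c (a.2.length, y)]? : Part ℕ).map fun b => decide (b = 1)).map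
        fun y => a.2 ++ [y] :=
    Partrec.map (Partrec.rfind hread)
      (Computable.list_concat.comp (Computable.snd.comp Computable.fst) Computable.snd).to₂
  have hsearch : Partrec₂ fun (a : List ℕ × ℕ × List ℕ) (b : ℕ) =>
      (forceSearch a.2.1 a.2.2 b).bind fun τ =>
        (Nat.rfind fun y => (a.1[c (τ.length, y)]? : Part ℕ).map fun b => decide (b = 1)).map
          fun y => τ ++ [y] :=
    Partrec.bind (partrec_forceSearch.comp
      ((Computable.snd.comp Computable.fst).pair Computable.snd))
      (happend.comp ((Computable.fst.comp (Computable.fst.comp Computable.fst)).pair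
        Computable.snd)).to₂
  have hstep : Partrec fun a : List ℕ × ℕ × List ℕ => (a.1[a.2.1]? : Part ℕ).bind fun b =>
      (forceSearch a.2.1 a.2.2 b).bind fun τ =>
        (Nat.rfind fun y => (a.1[c (τ.length, y)]? : Part ℕ).map fun b => decide (b = 1)).map
          fun y => τ ++ [y] :=
    Partrec.bind (Computable.ofOption (Computable.list_getElem?.comp Computable.fst
      (Computable.fst.comp Computable.snd))) hsearch
  have hheadI : Computable₂ fun (_ : List ℕ × ℕ) (σ : List ℕ) => σ.reverse.headI :=
    ((Primrec.list_headI.comp Primrec.list_reverse).to_comp.comp Computable.snd).to₂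
  exact turingLe_of_along (Partrec.map ((partrec_iterate (F := F) (σ₀ := stage q 0) hstep).comp
    (Computable.fst.pair (Computable.succ.comp Computable.snd))) hheadI).to₂
    fun n => hlast n ▸ (hstage (n + 1)).map fun l => l.reverse.headI

/-- **Friedberg jump inversion theorem.** For every `q ∈ ℕ^ℕ` with `0' ≤_T q`
there exists a `p ∈ ℕ^ℕ` with `p' ≡_T q`, where `p' = J(p)` is the Turing jump
of `p`. -/
theorem friedberg_jump_inversion (q : Baire) (h : TuringLe zero' q) :
    ∃ p : Baire, TuringLe (jump p) q ∧ TuringLe q (jump p) :=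
  ⟨generic q, jump_generic_turingLe h, turingLe_jump_generic q⟩

end LimitComp
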